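/- Let d ≥ 1 and let A, B, C, D be Hermitian d×d complex matrices. Let T be the matrix indexed by (Fin 4 → Fin d) with entries T_{i,j} = A_{i(0),j(0)}·B_{i(1),j(1)}·C_{i(2),j(2)}·D_{i(3),j(3)} (the Kronecker product A⊗B⊗C⊗D), and for a permutation π of Fin 4 let P_d(π) be the matrix indexed by (Fin 4 → Fin d) with P_d(π)_{i,j} = 1 if i = j∘π and 0 otherwise. Then d(d+1)(d+2)(d+3) · ∫ ⟨ψ, Aψ⟩·⟨ψ, Bψ⟩·⟨ψ, Cψ⟩·⟨ψ, Dψ⟩ dμ_d(ψ) = Σ_{π ∈ S_4} Tr(T · P_d(π)). -/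

import Mathlib

open MeasureTheory

noncomputable section

/-- `ℂ^d`. -/
abbrev Cvec (d : ℕ) : Type := EuclideanSpace ℂ (Fin d)

instance (d : ℕ) : MeasurableSpace (Cvec d) := borel _
instance (d : ℕ) : BorelSpace (Cvec d) := ⟨rfl⟩

/-- The unit sphere of `ℂ^d`. -/
abbrev USphere (d : ℕ) := Metric.sphere (0 : Cvec d) 1

/-- The action of a unitary (linear isometric equivalence) on the unit sphere. -/
def sphereRot (d : ℕ) (e : Cvec d ≃ₗᵢ[ℂ] Cvec d) (x : USphere d) : USphere d :=
  ⟨e x, by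
    have hx : ‖(x : Cvec d)‖ = 1 := mem_sphere_zero_iff_norm.mp x.2
    simp [mem_sphere_zero_iff_norm, e.norm_map, hx]⟩

/-- `μ` is the uniform (rotation-invariant) probability measure on the unit sphere of `ℂ^d`. -/
def IsUniformOnSphere (d : ℕ) (μ : Measure (USphere d)) : Prop :=
  IsProbabilityMeasure μ ∧
    ∀ e : Cvec d ≃ₗᵢ[ℂ] Cvec d, μ.map (sphereRot d e) = μ

/-- The permutation operator `P_d(π)` on `(ℂ^d)^{⊗k}`. -/
def permMat (d k : ℕ) (π : Equiv.Perm (Fin k)) : Matrix (Fin k → Fin d) (Fin k → Fin d) ℂ :=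
  fun i j => if i = j ∘ π then 1 else 0

/-- The quadratic form `⟨ψ, Aψ⟩ = Σ_{i,j} conj(ψ_i) A_{ij} ψ_j`. -/
def qForm (d : ℕ) (A : Matrix (Fin d) (Fin d) ℂ) (ψ : Cvec d) : ℂ :=
  ∑ i : Fin d, ∑ j : Fin d, star (ψ i) * A i j * ψ j

/-- The Kronecker product `A ⊗ B ⊗ C ⊗ D` as a matrix indexed by `Fin 4 → Fin d`. -/
def kron4 (d : ℕ) (A B C D : Matrix (Fin d) (Fin d) ℂ) :
    Matrix (Fin 4 → Fin d) (Fin 4 → Fin d) ℂ :=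
  fun i j => A (i 0) (j 0) * B (i 1) (j 1) * C (i 2) (j 2) * D (i 3) (j 3)

section

open Finset Polynomial

/-- Averaging a polynomial of degree `< n` over the `n`-th roots of unity gives its value at `0`. -/
lemma sum_eval_primitiveRoot_pow {n : ℕ} (hn : n ≠ 0) {ω : ℂ} (hω : IsPrimitiveRoot ω n)
    (P : ℂ[X]) (hP : P.natDegree < n) :
    ∑ m ∈ range n, P.eval (ω ^ m) = n * P.eval 0 := by
  simp_rw [eval_eq_sum_range' hP (ω ^ _)]
  rw [sum_comm, sum_eq_single 0]
  · simp [← coeff_zero_eq_eval_zero]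
  · intro k hk hk0
    rw [← mul_sum]
    have h1 : ω ^ k ≠ 1 := hω.pow_ne_one_of_pos_of_lt hk0 (mem_range.1 hk)
    have h2 : ∑ m ∈ range n, (ω ^ m) ^ k = 0 := by
      have h3 : (∑ m ∈ range n, (ω ^ k) ^ m) * (ω ^ k - 1) = 0 := by
        rw [geom_sum_mul, ← pow_mul, mul_comm, pow_mul, hω.pow_eq_one]; simp
      have h4 := (mul_eq_zero.1 h3).resolve_right (sub_ne_zero.2 h1)
      rw [← h4]
      exact sum_congr rfl fun m _ => by rw [← pow_mul, ← pow_mul, mul_comm]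
    rw [h2, mul_zero]
  · simp [hn]

/-- The sign vectors in `{1, -1}⁴`. -/
def signVec (e : Fin 2 × Fin 2 × Fin 2 × Fin 2) : Fin 4 → ℂ :=
  ![(-1) ^ (e.1 : ℕ), (-1) ^ (e.2.1 : ℕ), (-1) ^ (e.2.2.1 : ℕ), (-1) ^ (e.2.2.2 : ℕ)]

lemma sum_signVec_mul_pow_four (x : Fin 4 → ℂ) :
    ∑ e, (∏ k, signVec e k) * (∑ k, signVec e k * x k) ^ 4 = 384 * ∏ k, x k := by
  simp [signVec, Fintype.sum_prod_type, Fin.sum_univ_succ, Fin.prod_univ_succ]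
  ring

lemma sum_perm_prod_fin_succ {n : ℕ} (y : Fin (n + 1) → Fin (n + 1) → ℂ) :
    ∑ π : Equiv.Perm (Fin (n + 1)), ∏ k, y k (π k) =
      ∑ p, ∑ σ : Equiv.Perm (Fin n), y 0 p * ∏ k, y k.succ (Equiv.swap 0 p (σ k).succ) := by
  rw [← Equiv.sum_comp Equiv.Perm.decomposeFin.symm, Fintype.sum_prod_type]
  simp [Fin.prod_univ_succ]

lemma sum_perm_prod_fin_four (y : Fin 4 → Fin 4 → ℂ) :
    ∑ π : Equiv.Perm (Fin 4), ∏ k, y k (π k) =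
      y 0 0 * (y 1 1 * (y 2 2 * y 3 3 + y 2 3 * y 3 2) + y 1 2 * (y 2 1 * y 3 3 + y 2 3 * y 3 1) +
        y 1 3 * (y 2 1 * y 3 2 + y 2 2 * y 3 1)) +
      y 0 1 * (y 1 0 * (y 2 2 * y 3 3 + y 2 3 * y 3 2) + y 1 2 * (y 2 0 * y 3 3 + y 2 3 * y 3 0) +
        y 1 3 * (y 2 0 * y 3 2 + y 2 2 * y 3 0)) +
      y 0 2 * (y 1 0 * (y 2 1 * y 3 3 + y 2 3 * y 3 1) + y 1 1 * (y 2 0 * y 3 3 + y 2 3 * y 3 0) +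
        y 1 3 * (y 2 0 * y 3 1 + y 2 1 * y 3 0)) +
      y 0 3 * (y 1 0 * (y 2 1 * y 3 2 + y 2 2 * y 3 1) + y 1 1 * (y 2 0 * y 3 2 + y 2 2 * y 3 0) +
        y 1 2 * (y 2 0 * y 3 1 + y 2 1 * y 3 0)) := by
  have h2 (z : Fin 2 → Fin 2 → ℂ) : ∑ π : Equiv.Perm (Fin 2), ∏ k, z k (π k) =
      z 0 0 * z 1 1 + z 0 1 * z 1 0 := by
    rw [sum_perm_prod_fin_succ]; simp [Fin.sum_univ_succ]
  have h3 (z : Fin 3 → Fin 3 → ℂ) : ∑ π : Equiv.Perm (Fin 3), ∏ k, z k (π k) =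
      z 0 0 * (z 1 1 * z 2 2 + z 1 2 * z 2 1) + z 0 1 * (z 1 0 * z 2 2 + z 1 2 * z 2 0) +
      z 0 2 * (z 1 0 * z 2 1 + z 1 1 * z 2 0) := by
    rw [sum_perm_prod_fin_succ]
    simp_rw [← mul_sum]
    have := fun p : Fin 3 => h2 fun k l => z k.succ (Equiv.swap 0 p l.succ)
    simp only [this]
    rw [Fin.sum_univ_three]
    simp [Equiv.swap_apply_def]
    left
    ring
  rw [sum_perm_prod_fin_succ]
  simp_rw [← mul_sum]
  have := fun p : Fin 4 => h3 fun k l => y k.succ (Equiv.swap 0 p l.succ)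
  simp only [this]
  rw [Fin.sum_univ_four]
  have e : (2 : Fin 3).succ = 3 := rfl
  simp [Equiv.swap_apply_def, e]
  ring

lemma sum_pi_fin_succ {n : ℕ} {α M : Type*} [Fintype α] [AddCommMonoid M]
    (f : (Fin (n + 1) → α) → M) :
    ∑ i, f i = ∑ a, ∑ i : Fin n → α, f (Fin.cons a i) := by
  rw [← Fintype.sum_prod_type', ← Equiv.sum_comp (Fin.consEquiv fun _ => α)]
  rfl

/-- Prepending a coordinate multiplies the number of stabilising permutations, summed over the new
coordinate, by `d + n`. -/
lemma sum_card_stabilizer_cons (d n : ℕ) (i : Fin n → Fin d) :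
    ∑ a, ∑ π : Equiv.Perm (Fin (n + 1)), ∏ k,
        (if (Fin.cons a i : Fin (n + 1) → Fin d) k = (Fin.cons a i : Fin (n + 1) → Fin d) (π k)
          then (1 : ℂ) else 0) =
      (d + n) * ∑ π : Equiv.Perm (Fin n), ∏ k, (if i k = i (π k) then (1 : ℂ) else 0) := by
  have hterm (a : Fin d) (q : Fin n) :
      ∑ σ : Equiv.Perm (Fin n), (if a = i q then (1 : ℂ) else 0) * ∏ k,
        (if i k = (Fin.cons a i : Fin (n + 1) → Fin d) (Equiv.swap 0 q.succ (σ k).succ)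
          then (1 : ℂ) else 0) =
      (if a = i q then 1 else 0) *
        ∑ π : Equiv.Perm (Fin n), ∏ k, (if i k = i (π k) then (1 : ℂ) else 0) := by
    split_ifs with h
    · have hs (l : Fin n) :
          (Fin.cons a i : Fin (n + 1) → Fin d) (Equiv.swap 0 q.succ l.succ) = i l := by
        by_cases hl : l = q
        · simp [hl, h]
        · rw [Equiv.swap_apply_of_ne_of_ne (Fin.succ_ne_zero l)
            (fun h' => hl (Fin.succ_injective _ h'))]
          simp
      simp [hs]
    · simp
  have hrow (a : Fin d) := sum_perm_prod_fin_succ fun k l : Fin (n + 1) =>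
    if (Fin.cons a i : Fin (n + 1) → Fin d) k = (Fin.cons a i : Fin (n + 1) → Fin d) l
      then (1 : ℂ) else 0
  simp only [hrow]
  simp only [Fin.sum_univ_succ, Fin.cons_zero, Fin.cons_succ, hterm, sum_add_distrib]
  rw [sum_comm (s := univ (α := Fin d)) (t := univ (α := Fin n))]
  simp [add_mul]

lemma sum_card_stabilizer (d : ℕ) :
    ∑ i : Fin 4 → Fin d, ∑ π : Equiv.Perm (Fin 4), ∏ k, (if i k = i (π k) then (1 : ℂ) else 0) =
      (d : ℂ) * ((d : ℂ) + 1) * ((d : ℂ) + 2) * ((d : ℂ) + 3) := by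
  have hstep (n : ℕ) : ∑ i : Fin (n + 1) → Fin d, ∑ π : Equiv.Perm (Fin (n + 1)), ∏ k,
      (if i k = i (π k) then (1 : ℂ) else 0) = (d + n) * ∑ i : Fin n → Fin d,
        ∑ π : Equiv.Perm (Fin n), ∏ k, (if i k = i (π k) then (1 : ℂ) else 0) := by
    rw [sum_pi_fin_succ, sum_comm, mul_sum]
    exact sum_congr rfl fun i _ => sum_card_stabilizer_cons d n i
  rw [hstep 3, hstep 2, hstep 1, hstep 0]
  simp
  ring

lemma sum_signVec_mul_prod (y : Fin 4 → Fin 4 → ℂ) :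
    ∑ e, (∏ k, signVec e k) * ∏ k, ∑ l, signVec e l * y k l =
      16 * ∑ π : Equiv.Perm (Fin 4), ∏ k, y k (π k) := by
  rw [sum_perm_prod_fin_four]
  simp [signVec, Fintype.sum_prod_type, Fin.sum_univ_succ, Fin.prod_univ_succ]
  ring

lemma Continuous.integrable_uSphere {d : ℕ} {μ : Measure (USphere d)} [IsProbabilityMeasure μ]
    {f : USphere d → ℂ} (hf : Continuous f) : Integrable f μ :=
  hf.integrable_of_hasCompactSupport (HasCompactSupport.of_compactSpace f)

lemma continuous_sphereRot (d : ℕ) (e : Cvec d ≃ₗᵢ[ℂ] Cvec d) : Continuous (sphereRot d e) :=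
  (e.continuous.comp continuous_subtype_val).subtype_mk _

/-- Eighth absolute moments of linear forms depend only on the norm of the form. -/
lemma integral_abs_linear_pow (d : ℕ) (hd : 1 ≤ d) (μ : Measure (USphere d))
    (hμ : IsUniformOnSphere d μ) :
    ∃ c : ℂ, ∀ u : Fin d → ℂ,
      ∫ ψ : USphere d, (∑ i, star (u i) * ψ.1 i) ^ 4 * (∑ i, u i * star (ψ.1 i)) ^ 4 ∂μ =
        c * (∑ i, star (u i) * u i) ^ 4 := by
  have := hμ.1
  let i₀ : Fin d := ⟨0, hd⟩
  refine ⟨∫ ψ : USphere d, (ψ.1 i₀) ^ 4 * (star (ψ.1 i₀)) ^ 4 ∂μ, fun u => ?_⟩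
  by_cases hu : u = 0
  · simp [hu]
  let v : Cvec d := WithLp.toLp 2 u
  have hv : v ≠ 0 := by
    intro h; apply hu; ext i; simpa [v] using congrArg (fun w : Cvec d => w i) h
  have hvn : (‖v‖ : ℂ) ≠ 0 := by exact_mod_cast norm_ne_zero_iff.2 hv
  let n : Cvec d := ((‖v‖ : ℂ)⁻¹) • v
  have hn : ‖n‖ = 1 := by
    simp [n, norm_smul, norm_ne_zero_iff.2 hv]
  obtain ⟨b, hb⟩ := Orthonormal.exists_orthonormalBasis_extension_of_card_eq
    (𝕜 := ℂ) (E := Cvec d) (ι := Fin d) (by simp) (v := fun _ => n) (s := {i₀})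
    (by
      constructor
      · intro i; simpa using hn
      · intro i j hij; exact absurd (Subsingleton.elim i j) hij)
  have hb0 : b i₀ = n := hb i₀ rfl
  have key : ∀ ψ : USphere d, ∑ i, star (u i) * ψ.1 i = ‖v‖ * (sphereRot d b.repr ψ).1 i₀ := by
    intro ψ
    have : (sphereRot d b.repr ψ).1 i₀ = inner ℂ n ψ.1 := by
      rw [← hb0]; exact b.repr_apply_apply _ _
    rw [this, inner_smul_left]
    simp only [map_inv₀, Complex.conj_ofReal, ← mul_assoc, mul_inv_cancel₀ hvn, one_mul]
    simp [PiLp.inner_apply, v, mul_comm]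
  have key' : ∀ ψ : USphere d, ∑ i, u i * star (ψ.1 i) =
      ‖v‖ * star ((sphereRot d b.repr ψ).1 i₀) := by
    intro ψ
    have := congrArg star (key ψ)
    simpa [mul_comm] using this
  have hnorm : ∑ i, star (u i) * u i = (‖v‖ : ℂ) ^ 2 := by
    have := inner_self_eq_norm_sq_to_K (𝕜 := ℂ) v
    rw [PiLp.inner_apply] at this
    simpa [v, mul_comm, Complex.mul_conj'] using this
  simp_rw [key, key', hnorm]
  have hint : ∫ ψ : USphere d, (ψ.1 i₀) ^ 4 * (star (ψ.1 i₀)) ^ 4 ∂μ =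
      ∫ ψ : USphere d, ((sphereRot d b.repr ψ).1 i₀) ^ 4 *
        (star ((sphereRot d b.repr ψ).1 i₀)) ^ 4 ∂μ := by
    conv_lhs => rw [← hμ.2 b.repr]
    rw [integral_map (continuous_sphereRot d _).measurable.aemeasurable]
    exact Continuous.aestronglyMeasurable (by fun_prop)
  rw [hint, ← integral_mul_const]
  refine integral_congr_ae (.of_forall fun ψ => ?_)
  ring

lemma integral_linear_pow {d : ℕ} {μ : Measure (USphere d)} [IsProbabilityMeasure μ] {c : ℂ}
    (hc : ∀ u : Fin d → ℂ,
      ∫ ψ : USphere d, (∑ i, star (u i) * ψ.1 i) ^ 4 * (∑ i, u i * star (ψ.1 i)) ^ 4 ∂μ =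
        c * (∑ i, star (u i) * u i) ^ 4) (z w : Fin d → ℂ) :
    ∫ ψ : USphere d, (∑ i, z i * ψ.1 i) ^ 4 * (∑ i, w i * star (ψ.1 i)) ^ 4 ∂μ =
        c * (∑ i, z i * w i) ^ 4 := by
  have hω := Complex.isPrimitiveRoot_exp 9 (by norm_num)
  set ω := Complex.exp (2 * Real.pi * Complex.I / (9 : ℕ)) with hωdef
  have hstar : ∀ m : ℕ, ω ^ m * star (ω ^ m) = 1 := by
    intro m
    have : ‖ω ^ m‖ = 1 := by
      rw [norm_pow, hω.norm'_eq_one (by norm_num), one_pow]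
    rw [← starRingEnd_apply, Complex.mul_conj, Complex.normSq_eq_norm_sq, this]; simp
  have hmean : ∀ X Y X' Y' : ℂ, ∑ m ∈ range 9, (X + ω ^ m * Y) ^ 4 * (ω ^ m * X' + Y') ^ 4 =
      9 * (X ^ 4 * Y' ^ 4) := by
    intro X Y X' Y'
    have := sum_eval_primitiveRoot_pow (by norm_num) hω
      ((C X + Polynomial.X * C Y) ^ 4 * (Polynomial.X * C X' + C Y') ^ 4)
      (lt_of_le_of_lt (b := 8) (by compute_degree) (by norm_num))
    simpa [mul_comm (ω ^ _)] using this
  have hmean' : ∀ a b g : ℂ, ∑ m ∈ range 9, (a + ω ^ m * b + (ω ^ m) ^ 2 * g) ^ 4 =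
      9 * a ^ 4 := by
    intro a b g
    have := sum_eval_primitiveRoot_pow (by norm_num) hω
      ((C a + Polynomial.X * C b + Polynomial.X ^ 2 * C g) ^ 4)
      (lt_of_le_of_lt (b := 8) (by compute_degree) (by norm_num))
    simpa [mul_comm (ω ^ _), mul_comm ((ω ^ _) ^ 2)] using this
  have hrot : ∀ m : ℕ, ∫ ψ : USphere d, ((∑ i, z i * ψ.1 i) + ω ^ m * ∑ i, star (w i) * ψ.1 i) ^ 4 *
      (ω ^ m * (∑ i, star (z i) * star (ψ.1 i)) + ∑ i, w i * star (ψ.1 i)) ^ 4 ∂μ =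
      c * ((∑ i, z i * w i) + ω ^ m * (∑ i, (z i * star (z i) + star (w i) * w i)) +
        (ω ^ m) ^ 2 * ∑ i, star (w i) * star (z i)) ^ 4 := by
    intro m
    have hs := hstar m
    generalize ω ^ m = t at hs
    have h := congrArg (t ^ 4 * ·) (hc fun i => star (z i) + star t * w i)
    simp only [← integral_const_mul] at h
    convert h using 1
    · refine integral_congr_ae (.of_forall fun ψ => ?_)
      have e1 : ∑ i, star (star (z i) + star t * w i) * ψ.1 i =
          (∑ i, z i * ψ.1 i) + t * ∑ i, star (w i) * ψ.1 i := by
        rw [mul_sum, ← sum_add_distrib]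
        refine sum_congr rfl fun i _ => ?_
        simp only [star_add, star_mul', star_star]; ring
      have e2 : t * ∑ i, (star (z i) + star t * w i) * star (ψ.1 i) =
          t * (∑ i, star (z i) * star (ψ.1 i)) + ∑ i, w i * star (ψ.1 i) := by
        simp only [mul_sum]
        rw [← sum_add_distrib]
        refine sum_congr rfl fun i _ => ?_
        linear_combination (w i * star (ψ.1 i)) * hs
      simp only
      rw [e1, ← e2]; ring
    · have e3 : t * ∑ i, star (star (z i) + star t * w i) * (star (z i) + star t * w i) =
          (∑ i, z i * w i) + t * (∑ i, (z i * star (z i) + star (w i) * w i)) +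
            t ^ 2 * ∑ i, star (w i) * star (z i) := by
        simp only [mul_sum]
        rw [← sum_add_distrib, ← sum_add_distrib]
        refine sum_congr rfl fun i _ => ?_
        simp only [star_add, star_mul', star_star]
        linear_combination (w i * z i + t * w i * star (w i)) * hs
      rw [← e3]; ring
  have hsum := sum_congr (rfl : range 9 = range 9) fun m _ => hrot m
  rw [← integral_finsetSum _ fun m _ => Continuous.integrable_uSphere (by fun_prop),
    ← mul_sum, hmean'] at hsum
  simp_rw [hmean] at hsum
  rw [integral_const_mul] at hsum
  linear_combination hsum / 9

lemma integral_monomial {d : ℕ} {μ : Measure (USphere d)} [IsProbabilityMeasure μ] {c : ℂ}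
    (hc : ∀ z w : Fin d → ℂ,
      ∫ ψ : USphere d, (∑ i, z i * ψ.1 i) ^ 4 * (∑ i, w i * star (ψ.1 i)) ^ 4 ∂μ =
        c * (∑ i, z i * w i) ^ 4) (i j : Fin 4 → Fin d) :
    24 * ∫ ψ : USphere d, (∏ k, star (ψ.1 (i k))) * ∏ k, ψ.1 (j k) ∂μ =
      c * ∑ π : Equiv.Perm (Fin 4), ∏ k, (if j k = i (π k) then (1 : ℂ) else 0) := by
  have key : ∀ e e', ∫ ψ : USphere d, (∑ k, signVec e k * ψ.1 (j k)) ^ 4 *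
      (∑ l, signVec e' l * star (ψ.1 (i l))) ^ 4 ∂μ =
      c * (∑ k, signVec e k * ∑ l, signVec e' l * (if j k = i l then (1 : ℂ) else 0)) ^ 4 := by
    intro e e'
    have h := hc (fun a => ∑ k, signVec e k * if j k = a then 1 else 0)
      (fun a => ∑ l, signVec e' l * if i l = a then 1 else 0)
    have hl : ∀ (s : Fin 4 → ℂ) (q : Fin 4 → Fin d) (f : Fin d → ℂ),
        ∑ a, (∑ k, s k * if q k = a then 1 else 0) * f a = ∑ k, s k * f (q k) := by
      intro s q f
      simp_rw [sum_mul]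
      rw [sum_comm]
      simp
    rw [hl] at h
    simp_rw [hl] at h
    simpa [eq_comm] using h
  have hpt : ∀ ψ : USphere d, ∑ e', ∑ e, ((∏ k, signVec e' k) * ∏ k, signVec e k) *
      ((∑ k, signVec e k * ψ.1 (j k)) ^ 4 * (∑ l, signVec e' l * star (ψ.1 (i l))) ^ 4) =
      384 ^ 2 * ((∏ k, star (ψ.1 (i k))) * ∏ k, ψ.1 (j k)) := by
    intro ψ
    have h1 := sum_signVec_mul_pow_four fun k => ψ.1 (j k)
    have h2 := sum_signVec_mul_pow_four fun k => star (ψ.1 (i k))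
    have h3 := congrArg₂ (· * ·) h2 h1
    simp only [sum_mul_sum] at h3
    calc _ = _ := sum_congr rfl fun e' _ => sum_congr rfl fun e _ => by ring
      _ = _ := h3
      _ = _ := by ring
  have hI : 384 ^ 2 * ∫ ψ : USphere d, (∏ k, star (ψ.1 (i k))) * ∏ k, ψ.1 (j k) ∂μ =
      ∑ e', ∑ e, ((∏ k, signVec e' k) * ∏ k, signVec e k) *
        (c * (∑ k, signVec e k * ∑ l, signVec e' l * (if j k = i l then (1 : ℂ) else 0)) ^ 4) := by
    rw [← integral_const_mul]
    simp_rw [← hpt]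
    rw [integral_finsetSum _ fun e' _ => Continuous.integrable_uSphere (by fun_prop)]
    refine sum_congr rfl fun e' _ => ?_
    rw [integral_finsetSum _ fun e _ => Continuous.integrable_uSphere (by fun_prop)]
    refine sum_congr rfl fun e _ => ?_
    rw [integral_const_mul, key]
  have hR : ∑ e', ∑ e, ((∏ k, signVec e' k) * ∏ k, signVec e k) *
        (c * (∑ k, signVec e k * ∑ l, signVec e' l * (if j k = i l then (1 : ℂ) else 0)) ^ 4) =
      c * 384 * (16 * ∑ π : Equiv.Perm (Fin 4), ∏ k, (if j k = i (π k) then (1 : ℂ) else 0)) := by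
    rw [← sum_signVec_mul_prod (fun k l => if j k = i l then (1 : ℂ) else 0), mul_sum]
    refine sum_congr rfl fun e' _ => ?_
    have := sum_signVec_mul_pow_four
      fun k => ∑ l, signVec e' l * (if j k = i l then (1 : ℂ) else 0)
    calc _ = c * (∏ k, signVec e' k) * ∑ e, (∏ k, signVec e k) *
          (∑ k, signVec e k * ∑ l, signVec e' l * (if j k = i l then (1 : ℂ) else 0)) ^ 4 := by
          rw [mul_sum]
          exact sum_congr rfl fun e _ => by ring
      _ = _ := by rw [this]; ring
  rw [hR] at hI
  linear_combination hI / 6144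

lemma prod_qForm (d : ℕ) (M : Fin 4 → Matrix (Fin d) (Fin d) ℂ) (ψ : Cvec d) :
    ∏ k, qForm d (M k) ψ = ∑ i : Fin 4 → Fin d, ∑ j : Fin 4 → Fin d,
      (∏ k, M k (i k) (j k)) * ((∏ k, star (ψ (i k))) * ∏ k, ψ (j k)) := by
  simp only [qForm, prod_univ_sum, Fintype.piFinset_univ]
  refine sum_congr rfl fun i _ => sum_congr rfl fun j _ => ?_
  simp only [← prod_mul_distrib]
  exact prod_congr rfl fun k _ => by ring

/-- The monomials of bidegree `(4, 4)` have integrals given by counting permutations. -/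
lemma integral_monomial_eq (d : ℕ) (hd : 1 ≤ d) (μ : Measure (USphere d))
    (hμ : IsUniformOnSphere d μ) (i j : Fin 4 → Fin d) :
    ((d : ℂ) * ((d : ℂ) + 1) * ((d : ℂ) + 2) * ((d : ℂ) + 3)) *
      ∫ ψ : USphere d, (∏ k, star (ψ.1 (i k))) * ∏ k, ψ.1 (j k) ∂μ =
      ∑ π : Equiv.Perm (Fin 4), if j = i ∘ π then 1 else 0 := by
  have := hμ.1
  obtain ⟨c, hc⟩ := integral_abs_linear_pow d hd μ hμ
  have hmon := integral_monomial (integral_linear_pow hc)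
  have hone : ∀ ψ : USphere d, ∑ i : Fin 4 → Fin d,
      (∏ k, star (ψ.1 (i k))) * ∏ k, ψ.1 (i k) = 1 := by
    intro ψ
    have h1 : ∑ a, star (ψ.1 a) * ψ.1 a = 1 := by
      have := inner_self_eq_norm_sq_to_K (𝕜 := ℂ) ψ.1
      rw [PiLp.inner_apply, mem_sphere_zero_iff_norm.mp ψ.2] at this
      simpa [mul_comm, Complex.mul_conj'] using this
    have h2 : ∏ _k : Fin 4, ∑ a, star (ψ.1 a) * ψ.1 a = 1 := by simp only [h1, prod_const_one]
    rw [prod_univ_sum, Fintype.piFinset_univ] at h2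
    simpa only [prod_mul_distrib] using h2
  have htot : ∑ i : Fin 4 → Fin d, ∫ ψ : USphere d,
      (∏ k, star (ψ.1 (i k))) * ∏ k, ψ.1 (i k) ∂μ = 1 := by
    rw [← integral_finsetSum _ fun i _ => Continuous.integrable_uSphere (by fun_prop)]
    simp_rw [hone]
    simp
  have hnorm : 24 = c * ((d : ℂ) * ((d : ℂ) + 1) * ((d : ℂ) + 2) * ((d : ℂ) + 3)) := by
    rw [← sum_card_stabilizer, mul_sum, ← sum_congr rfl fun i _ => hmon i i, ← mul_sum, htot, mul_one]
  have hcard : ∑ π : Equiv.Perm (Fin 4), (if j = i ∘ π then (1 : ℂ) else 0) =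
      ∑ π : Equiv.Perm (Fin 4), ∏ k, (if j k = i (π k) then (1 : ℂ) else 0) := by
    refine sum_congr rfl fun π _ => ?_
    rw [prod_ite_zero]
    simp [funext_iff]
  rw [hcard]
  have hm := hmon i j
  linear_combination ((d : ℂ) * (d + 1) * (d + 2) * (d + 3)) / 24 * hm -
    (∑ π : Equiv.Perm (Fin 4), ∏ k, (if j k = i (π k) then (1 : ℂ) else 0)) / 24 * hnorm

end

/-- Fourth moment of quadratic forms of a random state:
`d(d+1)(d+2)(d+3) ∫ ⟨ψ,Aψ⟩⟨ψ,Bψ⟩⟨ψ,Cψ⟩⟨ψ,Dψ⟩ dμ = Σ_{π∈S₄} Tr((A⊗B⊗C⊗D)·P_d(π))`. -/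
theorem stmt18 (d : ℕ) (hd : 1 ≤ d)
    (μ : Measure (USphere d)) (hμ : IsUniformOnSphere d μ)
    (A B C D : Matrix (Fin d) (Fin d) ℂ)
    (hA : A.IsHermitian) (hB : B.IsHermitian) (hC : C.IsHermitian) (hD : D.IsHermitian) :
    ((d : ℂ) * ((d : ℂ) + 1) * ((d : ℂ) + 2) * ((d : ℂ) + 3)) *
        (∫ ψ : USphere d,
          qForm d A (↑ψ) * qForm d B (↑ψ) * qForm d C (↑ψ) * qForm d D (↑ψ) ∂μ)
      = ∑ π : Equiv.Perm (Fin 4), (kron4 d A B C D * permMat d 4 π).trace := by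
  have := hμ.1
  have hq : ∀ ψ : USphere d, qForm d A ψ * qForm d B ψ * qForm d C ψ * qForm d D ψ =
      ∑ i : Fin 4 → Fin d, ∑ j : Fin 4 → Fin d,
        kron4 d A B C D i j * ((∏ k, star (ψ.1 (i k))) * ∏ k, ψ.1 (j k)) := by
    intro ψ
    have h := prod_qForm d ![A, B, C, D] ψ
    simpa only [Fin.prod_univ_four, kron4, Matrix.cons_val] using h
  simp_rw [hq]
  rw [integral_finsetSum _ fun i _ => Continuous.integrable_uSphere (by fun_prop), Finset.mul_sum]
  simp only [Matrix.trace, Matrix.diag_apply, Matrix.mul_apply, permMat]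
  rw [Finset.sum_comm]
  refine Finset.sum_congr rfl fun i _ => ?_
  rw [integral_finsetSum _ fun i _ => Continuous.integrable_uSphere (by fun_prop), Finset.mul_sum,
    Finset.sum_comm]
  refine Finset.sum_congr rfl fun j _ => ?_
  rw [integral_const_mul, mul_left_comm, integral_monomial_eq d hd μ hμ, Finset.mul_sum]

end
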